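/- arXiv:2111.13638 — 6 statements merged into one kernel-verified Lean document; each statement's English description precedes it below -/
import Mathlib

section
/- Let D be an integer with D ≡ 1 (mod 8), D ≥ 17 and D ≠ 33. Then there exist an integer k ≥ 0 and e ∈ {−1, −3, −5, −7} such that D = e² + 16 + 32k, and for each a ∈ {0, 1} the quadruple (a, 4k + 2, 2, e) is a genus-two splitting prototype of discriminant D. In particular, the ratio (4k+2)/2 = 2k+1 of the two entries b and c is an odd integer. -/
/-- A genus-two splitting prototype of discriminant `D`: integers `(a,b,c,e)` with
`D = e² + 4bc`, `0 ≤ a < gcd(b,c)`, `c + e < b`, `0 < b`, `0 < c`, `gcd(a,b,c,e) = 1`. -/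
def IsG2Prototype (D a b c e : ℤ) : Prop :=
  D = e ^ 2 + 4 * b * c ∧ 0 ≤ a ∧ a < (Int.gcd b c : ℤ) ∧ c + e < b ∧ 0 < b ∧ 0 < c ∧
    Int.gcd (Int.gcd a b : ℤ) (Int.gcd c e : ℤ) = 1

theorem proto_aux (D k e : ℤ) (hk : 0 ≤ k) (he : e ∈ ({-1, -3, -5, -7} : Set ℤ))
    (hD : D = e ^ 2 + 16 + 32 * k) :
    ∃ k : ℤ, 0 ≤ k ∧ ∃ e ∈ ({-1, -3, -5, -7} : Set ℤ),
      D = e ^ 2 + 16 + 32 * k ∧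
      (∀ a ∈ ({0, 1} : Set ℤ), IsG2Prototype D a (4 * k + 2) 2 e) ∧
      (4 * k + 2) / 2 = 2 * k + 1 ∧ Odd (2 * k + 1) := by
  refine ⟨k, hk, e, he, hD, ?_, by omega, ⟨k, rfl⟩⟩
  have hneg : e < 0 := by
    rcases he with rfl | rfl | rfl | rfl <;> norm_num
  have hg : Int.gcd (4 * k + 2) 2 = 2 := by
    have h2 : (4 * k + 2) = 2 * (2 * k + 1) := by ring
    rw [h2]; simp
  have hce : Int.gcd 2 e = 1 := by
    rcases he with rfl | rfl | rfl | rfl <;> decide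
  intro a ha
  refine ⟨by rw [hD]; ring, ?_, ?_, by omega, by omega, by omega, ?_⟩
  · rcases ha with rfl | rfl <;> norm_num
  · rw [hg]; rcases ha with rfl | rfl <;> norm_num
  · rw [hce]; simp

theorem stmt_5 (D : ℤ) (hD1 : D % 8 = 1) (hD2 : 17 ≤ D) (hD3 : D ≠ 33) :
    ∃ k : ℤ, 0 ≤ k ∧ ∃ e ∈ ({-1, -3, -5, -7} : Set ℤ),
      D = e ^ 2 + 16 + 32 * k ∧
      (∀ a ∈ ({0, 1} : Set ℤ), IsG2Prototype D a (4 * k + 2) 2 e) ∧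
      (4 * k + 2) / 2 = 2 * k + 1 ∧ Odd (2 * k + 1) := by
  have h : D % 32 = 17 ∨ D % 32 = 25 ∨ D % 32 = 9 ∨ D % 32 = 1 := by omega
  rcases h with h | h | h | h
  · exact proto_aux D ((D - 17) / 32) (-1) (by omega) (by simp) (by omega)
  · exact proto_aux D ((D - 25) / 32) (-3) (by omega) (by simp) (by omega)
  · exact proto_aux D ((D - 41) / 32) (-5) (by omega) (by simp) (by omega)
  · exact proto_aux D ((D - 65) / 32) (-7) (by omega) (by simp) (by omega)
end

section
/- Let D ∈ {9, 33} and let (a, b, c, e) be a genus-two splitting prototype of discriminant D. Write b/c = p/q in lowest terms, i.e., p = b/gcd(b,c) and q = c/gcd(b,c). Then p and q are not both odd. -/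
theorem stmt_6 (D a b c e : ℤ) (hD : D = 9 ∨ D = 33) (h : IsG2Prototype D a b c e) :
    ¬ (Odd (b / (Int.gcd b c : ℤ)) ∧ Odd (c / (Int.gcd b c : ℤ))) := by
  obtain ⟨h1, -, -, -, hb, hc, -⟩ := h
  have hbc : b * c ≤ 8 := by
    rcases hD with rfl | rfl <;> nlinarith [sq_nonneg e]
  have hb8 : b ≤ 8 := by nlinarith
  have hc8 : c ≤ 8 := by nlinarith
  have he1 : e ≤ 5 := by rcases hD with rfl | rfl <;> nlinarith
  have he2 : -5 ≤ e := by rcases hD with rfl | rfl <;> nlinarith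
  clear hbc
  have key : ∀ b ∈ Finset.Icc (1 : ℤ) 8, ∀ c ∈ Finset.Icc (1 : ℤ) 8,
      ∀ e ∈ Finset.Icc (-5 : ℤ) 5, (e ^ 2 + 4 * b * c = 9 ∨ e ^ 2 + 4 * b * c = 33) →
      ¬ ((b / (Int.gcd b c : ℤ)) % 2 = 1 ∧ (c / (Int.gcd b c : ℤ)) % 2 = 1) := by
    decide +kernel
  rw [Int.odd_iff, Int.odd_iff]
  exact key b (Finset.mem_Icc.2 ⟨hb, hb8⟩) c (Finset.mem_Icc.2 ⟨hc, hc8⟩) e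
    (Finset.mem_Icc.2 ⟨he2, he1⟩) (h1 ▸ hD)
end

section
/- Let D be a positive integer that is not a perfect square, and let d be an integer with D ≡ d² (mod 8). Set ρ = (√D − d)/2 ∈ ℝ. Let P and Q be 2×2 integer matrices such that the real matrix P + ρ·Q has determinant 1. Then det P + ((D − d²)/4)·det Q = 1; in particular, since (D − d²)/4 is an even integer, det P is odd. -/
theorem stmt_7 (D : ℤ) (hDpos : 0 < D) (hDsq : ¬ IsSquare D) (d : ℤ)
    (hd : D % 8 = d ^ 2 % 8)
    (P Q : Matrix (Fin 2) (Fin 2) ℤ)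
    (hdet : (P.map ((↑) : ℤ → ℝ) +
        ((Real.sqrt D - d) / 2) • Q.map ((↑) : ℤ → ℝ)).det = 1) :
    P.det + ((D - d ^ 2) / 4) * Q.det = 1 ∧ Even ((D - d ^ 2) / 4) ∧ Odd P.det := by
  obtain ⟨j, hj⟩ : (8 : ℤ) ∣ D - d ^ 2 := by omega
  have hk : (D - d ^ 2) / 4 = 2 * j := by omega
  have hirr : Irrational (Real.sqrt (D : ℝ)) :=
    irrational_sqrt_intCast_iff.2 ⟨hDsq, hDpos.le⟩
  have hs : Real.sqrt (D : ℝ) * Real.sqrt (D : ℝ) = D :=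
    Real.mul_self_sqrt (by exact_mod_cast hDpos.le)
  have hjR : (D : ℝ) - d ^ 2 = 8 * j := by exact_mod_cast hj
  rw [hk]
  simp only [Matrix.det_fin_two, Matrix.add_apply, Matrix.smul_apply, Matrix.map_apply,
    smul_eq_mul] at hdet ⊢
  generalize P 0 0 = a at *
  generalize P 0 1 = b at *
  generalize P 1 0 = c at *
  generalize P 1 1 = e at *
  generalize Q 0 0 = x at *
  generalize Q 0 1 = y at *
  generalize Q 1 0 = z at *
  generalize Q 1 1 = w at *
  generalize Real.sqrt (D : ℝ) = s at *
  obtain ⟨A, hA⟩ : ∃ A : ℤ, A = a * e - b * c + 2 * j * (x * w - y * z) - 1 := ⟨_, rfl⟩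
  obtain ⟨B, hB⟩ : ∃ B : ℤ, B = a * w + x * e - b * z - y * c - d * (x * w - y * z) :=
    ⟨_, rfl⟩
  have hAR : (A : ℝ) = a * e - b * c + 2 * j * (x * w - y * z) - 1 := by
    rw [hA]; push_cast; ring
  have hBR : (B : ℝ) = a * w + x * e - b * z - y * c - d * (x * w - y * z) := by
    rw [hB]; push_cast; ring
  have key : 2 * (A : ℝ) - d * B + B * s = 0 := by
    rw [hAR, hBR]
    linear_combination 2 * hdet - (x * w - y * z) / 2 * hs - (x * w - y * z) / 2 * hjR
  have hB0 : B = 0 := by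
    by_contra hne
    have hneR : (B : ℝ) ≠ 0 := by exact_mod_cast hne
    apply hirr
    refine ⟨((d * B - 2 * A : ℤ) : ℚ) / (B : ℚ), ?_⟩
    push_cast
    rw [div_eq_iff hneR]
    linear_combination -key
  have hA0 : A = 0 := by
    rw [hB0] at key
    have : (A : ℝ) = 0 := by push_cast at key; linarith
    exact_mod_cast this
  refine ⟨by linarith, ⟨j, by ring⟩, ⟨-(j * (x * w - y * z)), by linarith⟩⟩
end

section
/- Let D be a positive integer that is not a perfect square with D ≡ 5 (mod 8), and let e be an odd integer. Set ρ = (√D + e)/2 ∈ ℝ, and in ℝ² set v₁ = (1/2, 1/2), v₂ = ((1 + ρ)/2, 1/2), v₃ = (1/2, (1 + ρ)/2). Let P and Q be 2×2 integer matrices, set A = P + ρ·Q as a real matrix, and assume det A = 1 and that A·v₁ − v₁ = a + ρ·b for some a, b ∈ ℤ². Then there exist u, k ∈ ℤ² such that A·v₂ − A·v₃ = u + (ρ/2)·k. In particular, the rational parts of A·v₂ and A·v₃ are congruent modulo ℤ². -/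
theorem stmt_9 (D : ℤ) (hDpos : 0 < D) (hDsq : ¬ IsSquare D) (hD5 : D % 8 = 5)
    (e : ℤ) (he : Odd e)
    (P Q : Matrix (Fin 2) (Fin 2) ℤ)
    (A : Matrix (Fin 2) (Fin 2) ℝ)
    (hA : A = P.map ((↑) : ℤ → ℝ) +
        ((Real.sqrt D + e) / 2) • Q.map ((↑) : ℤ → ℝ))
    (hdet : A.det = 1)
    (a b : Fin 2 → ℤ)
    (hfix : A.mulVec ![(1 : ℝ) / 2, 1 / 2] - ![(1 : ℝ) / 2, 1 / 2] =
        (fun i => ((a i : ℝ))) + ((Real.sqrt D + e) / 2) • (fun i => ((b i : ℝ)))) :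
    ∃ u k : Fin 2 → ℤ,
      A.mulVec ![(1 + (Real.sqrt D + e) / 2) / 2, (1 : ℝ) / 2] -
          A.mulVec ![(1 : ℝ) / 2, (1 + (Real.sqrt D + e) / 2) / 2] =
        (fun i => ((u i : ℝ))) + (((Real.sqrt D + e) / 2) / 2) • (fun i => ((k i : ℝ))) := by
  have hirr : Irrational (Real.sqrt (D : ℝ)) :=
    (irrational_sqrt_intCast_iff_of_nonneg hDpos.le).2 hDsq
  obtain ⟨c, hc⟩ := he
  obtain ⟨m, hm⟩ : ∃ m : ℤ, D = e ^ 2 + 4 * m := by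
    refine ⟨(D - e ^ 2) / 4, ?_⟩
    have h1 : e ^ 2 = 4 * (c * c + c) + 1 := by rw [hc]; ring
    omega
  have hsq : Real.sqrt (D : ℝ) * Real.sqrt (D : ℝ) = D :=
    Real.mul_self_sqrt (by exact_mod_cast hDpos.le)
  have hmR : (D : ℝ) = e ^ 2 + 4 * m := by exact_mod_cast hm
  generalize Real.sqrt (D : ℝ) = s at *
  have key : ∀ i, Q i 0 + Q i 1 = 2 * b i := by
    intro i
    have h := congrFun hfix i
    have h' : ((P i 0 + P i 1 - 1 - 2 * a i : ℤ) : ℝ)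
        + (s + e) / 2 * ((Q i 0 + Q i 1 - 2 * b i : ℤ) : ℝ) = 0 := by
      subst hA
      push_cast
      fin_cases i <;> simp at h ⊢ <;> linarith
    by_contra hne
    have hn : ((Q i 0 + Q i 1 - 2 * b i : ℤ) : ℝ) ≠ 0 := by
      exact_mod_cast sub_ne_zero.2 hne
    generalize Q i 0 + Q i 1 - 2 * b i = n at *
    generalize P i 0 + P i 1 - 1 - 2 * a i = p at *
    apply hirr
    refine ⟨-2 * (p : ℚ) / n - e, ?_⟩
    push_cast
    field_simp
    linarith
  refine ⟨fun i => m * (b i - Q i 1),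
    fun i => P i 0 - P i 1 + e * (Q i 0 - Q i 1), ?_⟩
  have hr : ((s + e) / 2) * ((s + e) / 2) = e * ((s + e) / 2) + m := by
    linarith
  subst hA
  funext i
  have hk : (Q i 0 : ℝ) = 2 * b i - Q i 1 := by
    have := key i
    have h2 : Q i 0 = 2 * b i - Q i 1 := by linarith
    exact_mod_cast h2
  generalize (s + e) / 2 = r at *
  fin_cases i
  · simp at hk ⊢
    rw [hk]
    linear_combination (b 0 - Q 0 1 : ℝ) * hr
  · simp at hk ⊢
    rw [hk]
    linear_combination (b 1 - Q 1 1 : ℝ) * hr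
end

section
/- Let G be a subgroup of the symmetric group on a 5-element set such that 10 divides the order of G, and suppose there exists a point x such that every element σ of G with σ(x) = x satisfies σ² = identity. Then G has order 10 and is isomorphic to the dihedral group of order 10. -/
/-- The action of the dihedral group on the vertices of the pentagon. -/
def dihFun : DihedralGroup 5 → Fin 5 → Fin 5
  | DihedralGroup.r i, y => y + (show Fin 5 from i)
  | DihedralGroup.sr i, y => -y - (show Fin 5 from i)

theorem dihFun_mul (a b : DihedralGroup 5) (y : Fin 5) :
    dihFun (a * b) y = dihFun a (dihFun b y) := by
  rcases a with i | i <;> rcases b with j | j <;> revert i j y <;> decide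

theorem dihFun_one (y : Fin 5) : dihFun 1 y = y := by
  revert y; decide

def dihHom : DihedralGroup 5 →* Equiv.Perm (Fin 5) where
  toFun a := ⟨dihFun a, dihFun a⁻¹,
    fun y => by rw [← dihFun_mul, inv_mul_cancel, dihFun_one],
    fun y => by rw [← dihFun_mul, mul_inv_cancel, dihFun_one]⟩
  map_one' := by ext y; exact congrArg _ (dihFun_one y)
  map_mul' a b := by ext y; exact congrArg _ (dihFun_mul a b y)

theorem dihHom_apply (a : DihedralGroup 5) (y : Fin 5) : dihHom a y = dihFun a y := rfl

theorem dihHom_inj : Function.Injective dihHom := by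
  rw [injective_iff_map_eq_one]
  intro a ha
  have h : ∀ y, dihFun a y = y := fun y => by rw [← dihHom_apply, ha]; rfl
  rcases a with i | i <;> revert i <;> decide

theorem r_fun (a : Fin 5) (y : Fin 5) : dihHom (DihedralGroup.r a) y = y + a := rfl

set_option maxRecDepth 100000 in
set_option maxHeartbeats 4000000 in
theorem key_fun : ∀ p q r s : Fin 5, 
    let f : Fin 5 → Fin 5 := ![0, p, q, r, s]
    (∀ y, f (f y) = y) →
    (∀ a b y : Fin 5, f (f y + a) + b = y → ∀ z, f (f (f (f z + a) + b) + a) + b = z) →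
    (∀ y, f y = y) ∨ (∀ y, f y = -y) := by
  decide

theorem main_aux (H : Subgroup (Equiv.Perm (Fin 5)))
    (hc : ∀ a, dihHom (DihedralGroup.r a) ∈ H)
    (hx : ∃ x : Fin 5, ∀ σ ∈ H, σ x = x → σ ^ 2 = 1) : H ≤ dihHom.range := by
  obtain ⟨x, hx⟩ := hx
  have hall : ∀ σ ∈ H, ∀ y, σ y = y → ∀ z, σ (σ z) = z := by
    intro σ hσ y hy z
    set c := dihHom (DihedralGroup.r (x - y)) with hcdef
    have hcy : c y = x := by rw [hcdef, r_fun]; abel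
    have hcx : c⁻¹ x = y := by rw [← hcy]; simp
    have hm : c * σ * c⁻¹ ∈ H := H.mul_mem (H.mul_mem (hc _) hσ) (H.inv_mem (hc _))
    have h1 := hx _ hm (by simp only [Equiv.Perm.mul_apply]; rw [hcx, hy, hcy])
    rw [conj_pow] at h1
    have h2 : σ ^ 2 = 1 := conj_eq_one_iff.mp h1
    have := congrArg (fun t : Equiv.Perm (Fin 5) => t z) h2
    simpa [pow_two] using this
  intro σ hσ
  set d : Fin 5 := - σ 0 with hd
  set τ := dihHom (DihedralGroup.r d) * σ with hτ
  have hτH : τ ∈ H := H.mul_mem (hc _) hσ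
  have h0 : τ 0 = 0 := by
    rw [hτ, Equiv.Perm.mul_apply, r_fun, hd]; abel
  have hf : ∀ y, (![0, τ 1, τ 2, τ 3, τ 4] : Fin 5 → Fin 5) y = τ y := by
    intro y; fin_cases y
    · exact h0.symm
    all_goals rfl
  have hk := key_fun (τ 1) (τ 2) (τ 3) (τ 4)
  simp only [hf] at hk
  have hτr : τ ∈ dihHom.range := by
    rcases hk (fun y => hall τ hτH 0 h0 y) (fun a b y hy z =>
      hall (dihHom (DihedralGroup.r b) * τ * dihHom (DihedralGroup.r a) * τ)
        (H.mul_mem (H.mul_mem (H.mul_mem (hc _) hτH) (hc _)) hτH) y hy z) with h | h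
    · have : τ = 1 := Equiv.ext h
      rw [this]; exact Subgroup.one_mem _
    · refine ⟨DihedralGroup.sr 0, Equiv.ext fun y => ?_⟩
      rw [h]; exact sub_zero (-y)
  have hs : σ = (dihHom (DihedralGroup.r d))⁻¹ * τ := by rw [hτ]; group
  rw [hs]
  exact Subgroup.mul_mem _ (Subgroup.inv_mem _ ⟨_, rfl⟩) hτr

theorem stmt_10 (G : Subgroup (Equiv.Perm (Fin 5))) (h10 : 10 ∣ Nat.card G)
    (hx : ∃ x : Fin 5, ∀ σ ∈ G, σ x = x → σ ^ 2 = 1) :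
    Nat.card G = 10 ∧ Nonempty (G ≃* DihedralGroup 5) := by
  have : Fact (Nat.Prime 5) := ⟨by norm_num⟩
  obtain ⟨⟨ρ, hρG⟩, hρ⟩ := exists_prime_orderOf_dvd_card' (G := G) 5
    (Dvd.dvd.trans (by norm_num) h10)
  have hρ5 : orderOf ρ = 5 := (Subgroup.orderOf_coe (⟨ρ, hρG⟩ : G)).trans hρ
  have hcyc : ρ.IsCycle := Equiv.Perm.isCycle_of_prime_order'' (by simp; norm_num)
    (by simpa using hρ5)
  set c := dihHom (DihedralGroup.r 1) with hc
  have hc5 : orderOf c = 5 := by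
    rw [hc, orderOf_injective _ dihHom_inj, DihedralGroup.orderOf_r_one]
  have hccyc : c.IsCycle := Equiv.Perm.isCycle_of_prime_order'' (by simp; norm_num)
    (by simpa using hc5)
  have hconj : IsConj c ρ := hccyc.isConj hcyc (by rw [← hccyc.orderOf, ← hcyc.orderOf, hc5, hρ5])
  obtain ⟨g, hg⟩ := isConj_iff.mp hconj
  -- conjugate
  set H := G.comap (MulAut.conj g).toMonoidHom with hH
  have hmem : ∀ σ, σ ∈ H ↔ g * σ * g⁻¹ ∈ G := fun σ => Iff.rfl
  have hcH : c ∈ H := by rw [hmem, hg]; exact hρG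
  have hall : ∀ a, dihHom (DihedralGroup.r a) ∈ H := by
    intro a
    have : DihedralGroup.r a = (DihedralGroup.r 1 : DihedralGroup 5) ^ (a.val) := by
      rw [DihedralGroup.r_one_pow, ZMod.natCast_zmod_val]
    rw [this, map_pow]
    exact H.pow_mem hcH _
  have hle : H ≤ dihHom.range := by
    refine main_aux H hall ?_
    obtain ⟨x, hx⟩ := hx
    refine ⟨g⁻¹ x, fun σ hσ hfix => ?_⟩
    have := hx _ ((hmem σ).1 hσ) (by simp only [Equiv.Perm.mul_apply]; rw [hfix]; simp)
    rw [conj_pow] at this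
    exact conj_eq_one_iff.mp this
  have e : H ≃* G := 
    (H.equivMapOfInjective (MulAut.conj g).toMonoidHom (MulAut.conj g).injective).trans
      (MulEquiv.subgroupCongr
        (Subgroup.map_comap_eq_self_of_surjective (MulAut.conj g).surjective G))
  have hcard : Nat.card H = Nat.card G := Nat.card_congr e.toEquiv
  have e2 : DihedralGroup 5 ≃* dihHom.range := MonoidHom.ofInjective dihHom_inj
  have hcr : Nat.card dihHom.range = 10 := by
    rw [← Nat.card_congr e2.toEquiv, DihedralGroup.nat_card]
  have hdvd : Nat.card H ∣ 10 := hcr ▸ Subgroup.card_dvd_of_le hle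
  have hG : Nat.card G = 10 := Nat.dvd_antisymm (hcard ▸ hdvd) h10
  have heq : H = dihHom.range := Subgroup.eq_of_le_of_card_ge hle (by rw [hcr, hcard, hG])
  exact ⟨hG, ⟨e.symm.trans ((MulEquiv.subgroupCongr heq).trans e2.symm)⟩⟩
end

section
/- Let D be a positive integer that is not a perfect square, and let d be an integer with D ≡ d² (mod 16). Set ρ = (√D − d)/2 ∈ ℝ. Let P and Q be 2×2 integer matrices such that both entries of the first row of Q are even, and such that the real matrix P + (ρ/2)·Q has determinant 1. Then det P + ((D − d²)/16)·det Q = 1; in particular, since det Q is even, det P is odd. -/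
theorem stmt_19 (D : ℤ) (hDpos : 0 < D) (hDsq : ¬ IsSquare D) (d : ℤ)
    (hd : D % 16 = d ^ 2 % 16)
    (P Q : Matrix (Fin 2) (Fin 2) ℤ)
    (hQ : Even (Q 0 0) ∧ Even (Q 0 1))
    (hdet : (P.map ((↑) : ℤ → ℝ) +
        (((Real.sqrt D - d) / 2) / 2) • Q.map ((↑) : ℤ → ℝ)).det = 1) :
    P.det + ((D - d ^ 2) / 16) * Q.det = 1 ∧ Even Q.det ∧ Odd P.det := by
  obtain ⟨k, hk⟩ : ∃ k, D - d ^ 2 = 16 * k := ⟨(D - d ^ 2) / 16, by omega⟩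
  have hk' : (D - d ^ 2) / 16 = k := by omega
  rw [hk']
  have hs : Real.sqrt D ^ 2 = (D : ℝ) := Real.sq_sqrt (by exact_mod_cast hDpos.le)
  have hkR : (D : ℝ) - d ^ 2 = 16 * k := by exact_mod_cast hk
  generalize Real.sqrt D = s at *
  simp only [Matrix.det_fin_two, Matrix.add_apply, Matrix.smul_apply, Matrix.map_apply,
    smul_eq_mul] at hdet ⊢
  generalize P 0 0 = a at *
  generalize P 0 1 = b at *
  generalize P 1 0 = c at *
  generalize P 1 1 = e at *
  generalize Q 0 0 = x at *
  generalize Q 0 1 = y at *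
  generalize Q 1 0 = z at *
  generalize Q 1 1 = w at *
  obtain ⟨B, hB⟩ : ∃ B : ℤ, B = 2 * (a * w + x * e - b * z - y * c) - d * (x * w - y * z) :=
    ⟨_, rfl⟩
  obtain ⟨A, hA⟩ : ∃ A : ℤ, A = 8 * ((a * e - b * c) + k * (x * w - y * z) - 1) - d * B :=
    ⟨_, rfl⟩
  have hlin : (A : ℝ) + s * B = 0 := by
    rw [hA, hB]
    push_cast
    linear_combination 8 * hdet - ((x : ℝ) * w - y * z) / 2 * (hs + hkR)
  have hsq : A ^ 2 = D * B ^ 2 := by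
    have : (A : ℝ) ^ 2 = D * B ^ 2 := by
      linear_combination (A - s * B : ℝ) * hlin + (B : ℝ) ^ 2 * hs
    exact_mod_cast this
  have hB0 : B = 0 := by
    by_contra h
    obtain ⟨r, rfl⟩ : B ∣ A := (Int.pow_dvd_pow_iff two_ne_zero).1 ⟨D, by rw [hsq]; ring⟩
    apply hDsq
    refine ⟨r, ?_⟩
    have : B ^ 2 ≠ 0 := pow_ne_zero 2 h
    apply mul_right_cancel₀ this
    linear_combination -hsq
  have hA0 : A = 0 := by
    rw [hB0] at hsq
    exact pow_eq_zero_iff two_ne_zero |>.1 (by simpa using hsq)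
  have h1 : (a * e - b * c) + k * (x * w - y * z) = 1 := by
    rw [hA0, hB0] at hA
    linarith
  have h2 : Even (x * w - y * z) := (hQ.1.mul_right w).sub (hQ.2.mul_right z)
  refine ⟨h1, h2, ?_⟩
  have h3 : a * e - b * c = 1 - k * (x * w - y * z) := by linarith
  rw [h3]
  exact odd_one.sub_even (h2.mul_left k)
end
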